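/- Minimax theorem for symmetric semidefinite zero-sum games: let A be a bisymmetric payoff tensor on Sym_n × Sym_n satisfying the skew symmetric relation A_{ijkl} = −A_{klij} for all i,j,k,l. Then there exists a solution strategy X̄, i.e., a matrix X̄ ∈ 𝒳_n such that the slice matrix A(X̄) is positive semidefinite. -/

import Mathlib

open Matrix BigOperators

/-- The spectraplex: real symmetric positive semidefinite `n×n` matrices with trace 1. -/
def Spectraplex (n : ℕ) : Set (Matrix (Fin n) (Fin n) ℝ) :=
  {X | X.IsSymm ∧ X.PosSemidef ∧ X.trace = 1}

/-- A bisymmetric payoff tensor. -/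
def Bisymm {m n : ℕ} (A : Fin m → Fin m → Fin n → Fin n → ℝ) : Prop :=
  ∀ i j k l, A i j k l = A j i k l ∧ A i j k l = A i j l k

/-- The slice matrix `A(X) ∈ Sym_n`, with entries `A(X)_{kl} = Σ_{i,j} X_{ij} A_{ijkl}`. -/
def sliceX {n : ℕ} (A : Fin n → Fin n → Fin n → Fin n → ℝ)
    (X : Matrix (Fin n) (Fin n) ℝ) : Matrix (Fin n) (Fin n) ℝ :=
  Matrix.of fun k l => ∑ i, ∑ j, X i j * A i j k l

theorem convex_spectraplex (n : ℕ) : Convex ℝ (Spectraplex n) := by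
  rintro X ⟨hXs, hXp, hXt⟩ Y ⟨hYs, hYp, hYt⟩ a b ha hb hab
  refine ⟨(hXs.smul a).add (hYs.smul b), (hXp.smul ha).add (hYp.smul hb), ?_⟩
  simp [hXt, hYt, hab]

theorem Matrix.PosSemidef.two_mul_abs_apply_le {n : Type*} [Fintype n] {X : Matrix n n ℝ}
    (hX : X.PosSemidef) (i j : n) : 2 * |X i j| ≤ X i i + X j j := by
  classical
  have hsymm : X j i = X i j := by simpa using hX.isHermitian.apply i j
  have hsub := hX.dotProduct_mulVec_nonneg (Pi.single i 1 - Pi.single j 1)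
  have hadd := hX.dotProduct_mulVec_nonneg (Pi.single i 1 + Pi.single j 1)
  simp [Matrix.mulVec_add, Matrix.mulVec_sub, dotProduct_add, dotProduct_sub, sub_dotProduct,
    add_dotProduct, hsymm] at hsub hadd
  cases abs_cases (X i j) <;> linarith

theorem abs_apply_le_one_of_mem_spectraplex {n : ℕ} {X : Matrix (Fin n) (Fin n) ℝ}
    (hX : X ∈ Spectraplex n) (i j : Fin n) : |X i j| ≤ 1 := by
  obtain ⟨-, hp, ht⟩ := hX
  have hdiag (k : Fin n) : X k k ≤ 1 := by
    rw [← ht]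
    exact Finset.single_le_sum (f := fun k => X k k) (fun _ _ => hp.diag_nonneg)
      (Finset.mem_univ k)
  linarith [hp.two_mul_abs_apply_le i j, hdiag i, hdiag j]

theorem isClosed_spectraplex (n : ℕ) : IsClosed (Spectraplex n) := by
  have h : Spectraplex n = {X | Xᵀ = X} ∩ ((⋂ v : Fin n → ℝ, {X | 0 ≤ v ⬝ᵥ X *ᵥ v}) ∩
      {X | X.trace = 1}) := by
    ext X
    simp only [Spectraplex, Set.mem_ofPred_eq, Set.mem_inter_iff, Set.mem_iInter,
      Matrix.posSemidef_iff_dotProduct_mulVec, Matrix.IsSymm, Matrix.IsHermitian,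
      Matrix.conjTranspose_eq_transpose_of_trivial, star_trivial]
    tauto
  rw [h]
  refine (isClosed_eq (by fun_prop) (by fun_prop)).inter (.inter ?_ ?_)
  · exact isClosed_iInter fun v => isClosed_le continuous_const (by fun_prop)
  · exact isClosed_eq (by fun_prop) continuous_const

theorem isCompact_spectraplex (n : ℕ) : IsCompact (Spectraplex n) := by
  have hbox : IsCompact (Set.univ.pi fun _ : Fin n => Set.univ.pi fun _ : Fin n =>
      Set.Icc (-1 : ℝ) 1) :=
    isCompact_univ_pi fun _ => isCompact_univ_pi fun _ => isCompact_Icc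
  exact hbox.of_isClosed_subset (isClosed_spectraplex n) fun X hX i _ j _ =>
    abs_le.mp (abs_apply_le_one_of_mem_spectraplex hX i j)

theorem inv_smul_vecMulVec_mem_spectraplex {n : ℕ} {v : Fin n → ℝ} (hv : v ≠ 0) :
    (v ⬝ᵥ v)⁻¹ • vecMulVec v v ∈ Spectraplex n := by
  have hpos : 0 ≤ v ⬝ᵥ v := by simpa using dotProduct_star_self_nonneg v
  have hne : v ⬝ᵥ v ≠ 0 := by simpa using hv
  have hp : (vecMulVec v v).PosSemidef := by
    simpa using Matrix.posSemidef_vecMulVec_self_star v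
  refine ⟨?_, hp.smul (inv_nonneg.mpr hpos), ?_⟩
  · ext i j
    simp [vecMulVec_apply, mul_comm]
  · simp [trace_vecMulVec, hne]

theorem spectraplex_nonempty {n : ℕ} (hn : 1 ≤ n) : (Spectraplex n).Nonempty := by
  have : NeZero n := ⟨by omega⟩
  exact ⟨_, inv_smul_vecMulVec_mem_spectraplex (v := 1) one_ne_zero⟩

/-- The payoff `⟨A(X), Y⟩` as a bilinear map. -/
def payoff {n : ℕ} (A : Fin n → Fin n → Fin n → Fin n → ℝ) :
    Matrix (Fin n) (Fin n) ℝ →ₗ[ℝ] Matrix (Fin n) (Fin n) ℝ →ₗ[ℝ] ℝ :=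
  LinearMap.mk₂ ℝ (fun X Y => ∑ k, ∑ l, sliceX A X k l * Y k l)
    (fun X X' Y => by simp [sliceX, add_mul, Finset.sum_add_distrib])
    (fun c X Y => by
      simp only [sliceX, of_apply, Matrix.smul_apply, smul_eq_mul, mul_assoc, ← Finset.mul_sum])
    (fun X Y Y' => by simp [mul_add, Finset.sum_add_distrib])
    (fun c X Y => by simp [Finset.mul_sum, mul_left_comm])

theorem payoff_apply {n : ℕ} (A : Fin n → Fin n → Fin n → Fin n → ℝ)
    (X Y : Matrix (Fin n) (Fin n) ℝ) :
    payoff A X Y = ∑ k, ∑ l, sliceX A X k l * Y k l := rfl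

theorem payoff_self {n : ℕ} {A : Fin n → Fin n → Fin n → Fin n → ℝ}
    (hskew : ∀ i j k l, A i j k l = - A k l i j) (X : Matrix (Fin n) (Fin n) ℝ) :
    payoff A X X = 0 := by
  have key : payoff A X X = - payoff A X X := by
    simp only [payoff_apply, sliceX, of_apply, Finset.sum_mul, ← Finset.sum_neg_distrib,
      ← Fintype.sum_prod_type']
    refine Fintype.sum_equiv ⟨fun p => (p.2.2.1, p.2.2.2, p.1, p.2.1),
      fun p => (p.2.2.1, p.2.2.2, p.1, p.2.1), fun _ => rfl, fun _ => rfl⟩ _ _ fun p => ?_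
    simp only [Equiv.coe_fn_mk]
    rw [hskew]
    ring
  linarith

theorem payoff_smul_vecMulVec {n : ℕ} (A : Fin n → Fin n → Fin n → Fin n → ℝ)
    (X : Matrix (Fin n) (Fin n) ℝ) (c : ℝ) (v : Fin n → ℝ) :
    payoff A X (c • vecMulVec v v) = c * (v ⬝ᵥ sliceX A X *ᵥ v) := by
  rw [map_smul, smul_eq_mul, payoff_apply]
  simp only [dotProduct, mulVec, vecMulVec_apply, Finset.mul_sum]
  refine Finset.sum_congr rfl fun k _ => Finset.sum_congr rfl fun l _ => ?_
  ring

/-- One direction of the self-duality of the positive semidefinite cone. -/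
theorem posSemidef_sliceX_of_payoff_nonneg {n : ℕ} {A : Fin n → Fin n → Fin n → Fin n → ℝ}
    (hA : Bisymm A) {X : Matrix (Fin n) (Fin n) ℝ}
    (h : ∀ Y ∈ Spectraplex n, 0 ≤ payoff A X Y) : (sliceX A X).PosSemidef := by
  refine Matrix.PosSemidef.of_dotProduct_mulVec_nonneg ?_ fun v => ?_
  · ext k l
    simp only [conjTranspose_apply, star_trivial, sliceX, of_apply]
    simp only [fun i j => (hA i j k l).2]
  · rcases eq_or_ne v 0 with rfl | hv
    · simp
    have hpos : 0 < v ⬝ᵥ v := by simpa using dotProduct_star_self_pos_iff.mpr hv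
    have hpay := h _ (inv_smul_vecMulVec_mem_spectraplex hv)
    rw [payoff_smul_vecMulVec] at hpay
    exact nonneg_of_mul_nonneg_right hpay (inv_pos.mpr hpos)

theorem minimax_symmetric_semidefinite_zero_sum {n : ℕ} (hn : 1 ≤ n)
    (A : Fin n → Fin n → Fin n → Fin n → ℝ) (hA : Bisymm A)
    (hskew : ∀ i j k l, A i j k l = - A k l i j) :
    ∃ Xbar ∈ Spectraplex n, (sliceX A Xbar).PosSemidef := by
  have hS := convex_spectraplex n
  have hcont (f : Matrix (Fin n) (Fin n) ℝ →ₗ[ℝ] ℝ) : Continuous f :=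
    f.continuous_of_finiteDimensional
  obtain ⟨a, ha, b, hb, hab⟩ := Sion.exists_isSaddlePointOn
    (X := Spectraplex n) (Y := Spectraplex n) (f := fun X Y => (-payoff A) X Y)
    (spectraplex_nonempty hn) hS (isCompact_spectraplex n)
    (fun Y _ => (hcont ((-payoff A).flip Y)).lowerSemicontinuous.lowerSemicontinuousOn _)
    (fun Y _ => (((-payoff A).flip Y).convexOn hS).quasiconvexOn)
    hS (spectraplex_nonempty hn) (isCompact_spectraplex n)
    (fun X _ => (hcont ((-payoff A) X)).upperSemicontinuous.upperSemicontinuousOn _)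
    (fun X _ => (((-payoff A) X).concaveOn hS).quasiconcaveOn)
  refine ⟨a, ha, posSemidef_sliceX_of_payoff_nonneg hA fun Y hY => ?_⟩
  simpa [payoff_self hskew] using hab b hb Y hY
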